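/- Let Q ∈ ℝ^{m×r} and Q_⊥ ∈ ℝ^{m×(m−r)} form an orthogonal completion, let Y ∈ ℝ^{m×s}, and assume N := Yᵀ Q has full column rank r. Then for every B ∈ ℝ^{m×q}, the decomposition N† Yᵀ B = N† (Yᵀ Q_⊥)(Q_⊥ᵀ B) + Qᵀ B holds, where N† = (NᵀN)⁻¹Nᵀ. -/

import Mathlib

open scoped BigOperators Matrix

/-- Moore–Penrose pseudoinverse of a full-column-rank matrix: `(MᵀM)⁻¹Mᵀ`. -/
noncomputable def pinvCol {α β : Type*} [Fintype α] [Fintype β] [DecidableEq β]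
    (M : Matrix α β ℝ) : Matrix β α ℝ := (Mᵀ * M)⁻¹ * Mᵀ

/-- A square matrix over a field whose rank is its size is invertible. -/
theorem Matrix.isUnit_of_rank_eq_card {n K : Type*} [Fintype n] [DecidableEq n] [Field K]
    {A : Matrix n n K} (hA : A.rank = Fintype.card n) : IsUnit A := by
  rw [← Matrix.mulVec_surjective_iff_isUnit]
  have hrange : LinearMap.range A.mulVecLin = ⊤ := by
    apply Submodule.eq_top_of_finrank_eq
    rw [Module.finrank_fintype_fun_eq_card]
    exact hA
  exact LinearMap.range_eq_top.mp hrange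

/-- The pseudoinverse of a matrix of full column rank is a left inverse. -/
theorem pinvCol_mul_self {α β : Type*} [Fintype α] [Fintype β] [DecidableEq β]
    {M : Matrix α β ℝ} (hM : M.rank = Fintype.card β) : pinvCol M * M = 1 := by
  have hunit : IsUnit (Mᵀ * M) :=
    Matrix.isUnit_of_rank_eq_card ((Matrix.rank_transpose_mul_self M).trans hM)
  rw [pinvCol, Matrix.mul_assoc]
  exact Matrix.nonsing_inv_mul _ ((Matrix.isUnit_iff_isUnit_det _).mp hunit)

/-- If `(Q, Q_⊥)` is an orthogonal completion and `N = Yᵀ Q` has full column rank, then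
`N† Yᵀ B = N† (YᵀQ_⊥)(Q_⊥ᵀ B) + Qᵀ B` for every `B`. -/
theorem pinv_decomposition_orthogonal_completion
    {m r s q : ℕ}
    (Q : Matrix (Fin m) (Fin r) ℝ) (Qp : Matrix (Fin m) (Fin (m - r)) ℝ)
    (hQ : Qᵀ * Q = 1) (hQp : Qpᵀ * Qp = 1) (hQQp : Qᵀ * Qp = 0)
    (hcomp : Q * Qᵀ + Qp * Qpᵀ = 1)
    (Y : Matrix (Fin m) (Fin s) ℝ)
    (hN : (Yᵀ * Q).rank = r) :
    ∀ B : Matrix (Fin m) (Fin q) ℝ,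
      pinvCol (Yᵀ * Q) * Yᵀ * B =
        pinvCol (Yᵀ * Q) * (Yᵀ * Qp) * (Qpᵀ * B) + Qᵀ * B := by
  intro B
  have hinv : pinvCol (Yᵀ * Q) * (Yᵀ * Q) = 1 := pinvCol_mul_self (by simpa using hN)
  calc pinvCol (Yᵀ * Q) * Yᵀ * B
      = pinvCol (Yᵀ * Q) * Yᵀ * ((Q * Qᵀ + Qp * Qpᵀ) * B) := by rw [hcomp, Matrix.one_mul]
    _ = pinvCol (Yᵀ * Q) * (Yᵀ * Qp) * (Qpᵀ * B) +
          pinvCol (Yᵀ * Q) * (Yᵀ * Q) * (Qᵀ * B) := by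
        simp only [Matrix.add_mul, Matrix.mul_add, Matrix.mul_assoc]
        exact add_comm _ _
    _ = pinvCol (Yᵀ * Q) * (Yᵀ * Qp) * (Qpᵀ * B) + Qᵀ * B := by rw [hinv, Matrix.one_mul]
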